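/- Let X be a metric space, n ≥ 3, and let x : Fin n → X be an injective optimal tour. Let i, j ∈ Fin n be such that i, i+1, j, j+1 are four distinct indices (addition mod n), and suppose z ∈ X is metrically between x i and x (i+1) and also metrically between x j and x (j+1). Then z is metrically between x i and x j, and z is metrically between x (i+1) and x (j+1). -/

import Mathlib

def revFun (n c : ℕ) (hc : c ≤ n) (k : Fin n) : Fin n :=
  if k.val < c then ⟨c - 1 - k.val, by omega⟩ else k

theorem revFun_val (n c : ℕ) (hc : c ≤ n) (k : Fin n) :
    (revFun n c hc k).val = if k.val < c then c - 1 - k.val else k.val := by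
  unfold revFun
  split_ifs <;> rfl

theorem revFun_invol (n c : ℕ) (hc : c ≤ n) : Function.Involutive (revFun n c hc) := by
  intro k
  apply Fin.ext
  rw [revFun_val, revFun_val]
  split_ifs <;> omega

theorem fin_succ_val {n : ℕ} [NeZero n] (hn : 3 ≤ n) (k : Fin n) :
    (k + 1).val = if k.val + 1 = n then 0 else k.val + 1 := by
  have h1 : (1 : Fin n).val = 1 := by
    rw [Fin.val_one', Nat.mod_eq_of_lt (by omega)]
  rw [Fin.val_add, h1]
  have := k.isLt
  split_ifs with h
  · rw [h, Nat.mod_self]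
  · exact Nat.mod_eq_of_lt (by omega)

theorem two_opt_aux {X : Type*} [MetricSpace X] {n : ℕ} [NeZero n] (hn : 3 ≤ n)
    (y : Fin n → X)
    (hopt : ∀ σ : Equiv.Perm (Fin n),
      ∑ k : Fin n, dist (y k) (y (k + 1)) ≤
        ∑ k : Fin n, dist (y (σ k)) (y (σ (k + 1))))
    (l m : Fin n) (hl : l.val + 1 = n) (hm : m.val + 1 < n) :
    dist (y l) (y (l + 1)) + dist (y m) (y (m + 1)) ≤
      dist (y l) (y m) + dist (y (l + 1)) (y (m + 1)) := by
  set τ := (revFun_invol n (m.val + 1) hm.le).toPerm with hτ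
  set ρ := (revFun_invol n m.val m.isLt.le).toPerm with hρ
  have hτv : ∀ k, (τ k).val = if k.val < m.val + 1 then m.val + 1 - 1 - k.val else k.val :=
    fun k => revFun_val _ _ hm.le k
  have hρv : ∀ k, (ρ k).val = if k.val < m.val then m.val - 1 - k.val else k.val :=
    fun k => revFun_val _ _ m.isLt.le k
  have hs := fin_succ_val hn
  have h := hopt τ
  rw [← Equiv.sum_comp ρ (fun k => dist (y k) (y (k + 1)))] at h
  have hlm : l ≠ m := by rintro rfl; omega
  have key : ∑ k : Fin n, (dist (y (τ k)) (y (τ (k + 1))) - dist (y (ρ k)) (y (ρ k + 1))) =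
      (dist (y (τ l)) (y (τ (l + 1))) - dist (y (ρ l)) (y (ρ l + 1))) +
      (dist (y (τ m)) (y (τ (m + 1))) - dist (y (ρ m)) (y (ρ m + 1))) := by
    apply Fintype.sum_eq_add l m hlm
    rintro k ⟨hkl, hkm⟩
    have hkl' : k.val ≠ l.val := fun e => hkl (Fin.ext e)
    have hkm' : k.val ≠ m.val := fun e => hkm (Fin.ext e)
    have hk := k.isLt
    by_cases hlt : k.val < m.val
    · have e1 : τ k = ρ k + 1 := by
        apply Fin.ext
        rw [hs, hτv, hρv]
        split_ifs <;> omega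
      have e2 : τ (k + 1) = ρ k := by
        apply Fin.ext
        rw [hτv, hρv, hs]
        split_ifs <;> omega
      rw [e1, e2, dist_comm, sub_self]
    · have e1 : τ k = ρ k := by
        apply Fin.ext
        rw [hτv, hρv]
        split_ifs <;> omega
      have e2 : τ (k + 1) = ρ k + 1 := by
        apply Fin.ext
        rw [hτv, hs, hs, hρv]
        split_ifs <;> omega
      rw [e1, e2, sub_self]
  have a1 : τ l = l := by
    apply Fin.ext; rw [hτv]; split_ifs <;> omega
  have a2 : τ (l + 1) = m := by
    apply Fin.ext; rw [hτv, hs]; split_ifs <;> omega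
  have a3 : ρ l = l := by
    apply Fin.ext; rw [hρv]; split_ifs <;> omega
  have a4 : τ m = l + 1 := by
    apply Fin.ext; rw [hτv, hs]; split_ifs <;> omega
  have a5 : τ (m + 1) = m + 1 := by
    apply Fin.ext; rw [hτv, hs]; split_ifs <;> omega
  have a6 : ρ m = m := by
    apply Fin.ext; rw [hρv]; split_ifs <;> omega
  rw [a1, a2, a3, a4, a5, a6, Finset.sum_sub_distrib] at key
  linarith

theorem optimal_tour_crossing_point_between
    {X : Type*} [MetricSpace X] {n : ℕ} [NeZero n] (hn : 3 ≤ n)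
    (x : Fin n → X) (hinj : Function.Injective x)
    (hopt : ∀ σ : Equiv.Perm (Fin n),
      ∑ k : Fin n, dist (x k) (x (k + 1)) ≤
        ∑ k : Fin n, dist (x (σ k)) (x (σ (k + 1))))
    (i j : Fin n)
    (hdistinct : ({i, i + 1, j, j + 1} : Finset (Fin n)).card = 4)
    (z : X)
    (hzi : dist (x i) z + dist z (x (i + 1)) = dist (x i) (x (i + 1)))
    (hzj : dist (x j) z + dist z (x (j + 1)) = dist (x j) (x (j + 1))) :
    dist (x i) z + dist z (x j) = dist (x i) (x j) ∧
      dist (x (i + 1)) z + dist z (x (j + 1)) = dist (x (i + 1)) (x (j + 1)) := by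
  have hij : i ≠ j := by
    rintro rfl
    have h2 : ({i, i + 1, i, i + 1} : Finset (Fin n)) = {i, i + 1} := by
      ext a; simp
    rw [h2] at hdistinct
    have := Finset.card_le_two (a := i) (b := i + 1)
    omega
  let l : Fin n := ⟨n - 1, by omega⟩
  have hl : l.val + 1 = n := by simp only [l]; omega
  have main : dist (x i) (x (i + 1)) + dist (x j) (x (j + 1)) ≤
      dist (x i) (x j) + dist (x (i + 1)) (x (j + 1)) := by
    let e : Equiv.Perm (Fin n) := Equiv.addRight (i - l)
    have he : ∀ k, e k = k + (i - l) := fun k => rfl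
    have hes : ∀ k, e (k + 1) = e k + 1 := fun k => by rw [he, he]; abel
    have hm : (j - (i - l)).val + 1 < n := by
      have h1 := (j - (i - l)).isLt
      have h2 : (j - (i - l)).val ≠ l.val := by
        intro h
        have h3 := Fin.ext h
        apply hij
        have : j = (j - (i - l)) + (i - l) := by abel
        rw [h3] at this
        rw [this]; abel
      omega
    have := two_opt_aux hn (fun k => x (e k)) (by
      intro σ
      have h := hopt ((e.symm.trans σ).trans e)
      rw [← Equiv.sum_comp e, ← Equiv.sum_comp e
        (fun k => dist (x (((e.symm.trans σ).trans e) k)) _)] at h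
      simpa [← hes] using h) l (j - (i - l)) hl hm
    have el : e l = i := by rw [he]; abel
    have em : e (j - (i - l)) = j := by rw [he]; abel
    simpa only [hes, el, em] using this
  have t1 := dist_triangle (x i) z (x j)
  have t2 := dist_triangle (x (i + 1)) z (x (j + 1))
  rw [dist_comm z (x (i + 1))] at hzi
  rw [dist_comm (x j) z] at hzj
  constructor <;> linarith
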